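/- Let K be a compact Hausdorff space, let f : K → ℝ be bounded and universally measurable, and define f̃ : M¹(K) → ℝ by f̃(μ) = ∫ f dμ. If f ∈ Hf_1(K), then f̃ ∈ Hf_1(M¹(K)); if f ∈ Bof_1(K), then f̃ ∈ Bof_1(M¹(K)). -/

import Mathlib

open MeasureTheory Filter Topology Set

noncomputable section

/-- The first uncountable ordinal `ω₁`. -/
def omega1 : Ordinal.{0} := (Cardinal.aleph 1).ord

/-- A subset `A` of a topological space is *resolvable* (an `H`-set) if every nonempty
subset `B` has a nonempty relatively open piece entirely inside `A` or disjoint from `A`. -/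
def Resolvable {X : Type*} [TopologicalSpace X] (A : Set X) : Prop :=
  ∀ B : Set X, B.Nonempty →
    ∃ U : Set X, IsOpen U ∧ (B ∩ U).Nonempty ∧ (B ∩ U ⊆ A ∨ B ∩ U ∩ A = ∅)

/-- The algebra of sets generated by a collection `G`. -/
inductive AlgGen {X : Type*} (G : Set X → Prop) : Set X → Prop
  | basic (s : Set X) : G s → AlgGen G s
  | empty : AlgGen G ∅
  | compl (s : Set X) : AlgGen G s → AlgGen G sᶜ
  | union (s t : Set X) : AlgGen G s → AlgGen G t → AlgGen G (s ∪ t)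

/-- `Bos X` : the algebra of sets generated by the open subsets of `X`. -/
def Bos (X : Type*) [TopologicalSpace X] : Set X → Prop :=
  AlgGen fun s : Set X => IsOpen s

/-- `Hs X` : the algebra of sets generated by the resolvable subsets of `X`. -/
def Hs (X : Type*) [TopologicalSpace X] : Set X → Prop :=
  AlgGen fun s : Set X => Resolvable s

/-- `Σ₂(F)` : countable unions of members of the family `F`. -/
def SigmaTwo {X : Type*} (F : Set X → Prop) (s : Set X) : Prop :=
  ∃ g : ℕ → Set X, (∀ n, F (g n)) ∧ s = ⋃ n, g n

/-- `Σ₂(F)`-measurability of a function: preimages of open sets lie in `Σ₂(F)`. -/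
def SigmaTwoMeasurable {X Y : Type*} [TopologicalSpace Y] (F : Set X → Prop)
    (f : X → Y) : Prop :=
  ∀ U : Set Y, IsOpen U → SigmaTwo F (f ⁻¹' U)

/-- The hierarchy of functions obtained from the class `F0` (put at level `1`) by
iterated pointwise limits of sequences. -/
inductive FunHier {X Y : Type*} [TopologicalSpace Y] (F0 : (X → Y) → Prop) :
    Ordinal.{0} → (X → Y) → Prop
  | base (f : X → Y) : F0 f → FunHier F0 1 f
  | lim (α : Ordinal.{0}) (β : ℕ → Ordinal.{0}) (g : ℕ → X → Y) (f : X → Y) :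
      (∀ n, 1 ≤ β n) → (∀ n, β n < α) → (∀ n, FunHier F0 (β n) (g n)) →
      (∀ x, Tendsto (fun n => g n x) atTop (𝓝 (f x))) → FunHier F0 α f

/-- The classes `Hf_α(X)` of resolvably measurable functions, `1 ≤ α < ω₁`. -/
def HfClass (X : Type*) [TopologicalSpace X] {Y : Type*} [TopologicalSpace Y]
    (α : Ordinal.{0}) (f : X → Y) : Prop :=
  FunHier (SigmaTwoMeasurable (Hs X)) α f

/-- The classes `Bof_α(X)` of Borel measurable functions, `1 ≤ α < ω₁`. -/
def BofClass (X : Type*) [TopologicalSpace X] {Y : Type*} [TopologicalSpace Y]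
    (α : Ordinal.{0}) (f : X → Y) : Prop :=
  FunHier (SigmaTwoMeasurable (Bos X)) α f

/-- The Baire classes: `C_0(X)` consists of the continuous functions and, for `α ≥ 1`,
`C_α(X)` consists of the pointwise limits of sequences of functions of lower classes. -/
inductive BaireClass (X : Type*) [TopologicalSpace X] (Y : Type*) [TopologicalSpace Y] :
    Ordinal.{0} → (X → Y) → Prop
  | base (f : X → Y) : Continuous f → BaireClass X Y 0 f
  | lim (α : Ordinal.{0}) (β : ℕ → Ordinal.{0}) (g : ℕ → X → Y) (f : X → Y) :
      (∀ n, β n < α) → (∀ n, BaireClass X Y (β n) (g n)) →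
      (∀ x, Tendsto (fun n => g n x) atTop (𝓝 (f x))) → BaireClass X Y α f

/-- The space `M¹(K)` of Radon probability measures on `K`, equipped with the weak*
topology (the topology of weak convergence of probability measures). -/
def RadonProb (K : Type*) [TopologicalSpace K] [MeasurableSpace K] [OpensMeasurableSpace K] :
    Type _ :=
  {μ : ProbabilityMeasure K // μ.toMeasure.InnerRegular}

instance (K : Type*) [TopologicalSpace K] [MeasurableSpace K] [OpensMeasurableSpace K] :
    TopologicalSpace (RadonProb K) :=
  inferInstanceAs (TopologicalSpace {μ : ProbabilityMeasure K // μ.toMeasure.InnerRegular})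

/-- The underlying measure of an element of `M¹(K)`. -/
def RadonProb.measure {K : Type*} [TopologicalSpace K] [MeasurableSpace K]
    [OpensMeasurableSpace K] (μ : RadonProb K) : Measure K :=
  (Subtype.val μ : ProbabilityMeasure K).toMeasure

/-- A universally measurable set: measurable with respect to every Radon probability
measure. -/
def UnivMeasurableSet {K : Type*} [TopologicalSpace K] [MeasurableSpace K] (H : Set K) : Prop :=
  ∀ μ : ProbabilityMeasure K, μ.toMeasure.InnerRegular → NullMeasurableSet H μ.toMeasure

/-- A universally measurable function: measurable with respect to every Radon
probability measure. -/
def UnivMeasurableFn {K : Type*} [TopologicalSpace K] [MeasurableSpace K] (f : K → ℝ) : Prop :=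
  ∀ μ : ProbabilityMeasure K, μ.toMeasure.InnerRegular → AEMeasurable f μ.toMeasure


lemma hf_iff {X Y : Type*} [TopologicalSpace Y] (F0 : (X → Y) → Prop) (f : X → Y) :
    FunHier F0 1 f ↔ F0 f := by
  constructor
  · intro h
    cases h with
    | base _ h => exact h
    | lim _ β g _ h1 h2 h3 h4 => exact absurd (h2 0) (not_lt.2 (h1 0))
  · exact FunHier.base f

section alg
variable {X : Type*} {G : Set X → Prop}

lemma AlgGen.inter {s t : Set X} (hs : AlgGen G s) (ht : AlgGen G t) : AlgGen G (s ∩ t) := by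
  have := AlgGen.compl _ (AlgGen.union _ _ (AlgGen.compl _ hs) (AlgGen.compl _ ht))
  rwa [compl_union, compl_compl, compl_compl] at this

lemma sigma_iUnion {ι : Type*} [Countable ι] {s : ι → Set X}
    (h : ∀ i, SigmaTwo (AlgGen G) (s i)) : SigmaTwo (AlgGen G) (⋃ i, s i) := by
  rcases isEmpty_or_nonempty ι with hι | hι
  · exact ⟨fun _ => ∅, fun _ => AlgGen.empty, by simp⟩
  · choose g hg hs using h
    obtain ⟨e, he⟩ := exists_surjective_nat (ι × ℕ)
    refine ⟨fun n => g (e n).1 (e n).2, fun n => hg _ _, ?_⟩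
    ext x
    simp only [hs, mem_iUnion]
    constructor
    · rintro ⟨i, n, h⟩
      obtain ⟨k, hk⟩ := he (i, n)
      exact ⟨k, by simpa [hk] using h⟩
    · rintro ⟨k, h⟩
      exact ⟨_, _, h⟩

lemma sigma_of {s : Set X} (h : AlgGen G s) : SigmaTwo (AlgGen G) s :=
  ⟨fun _ => s, fun _ => h, by simp [iUnion_const]⟩

lemma sigma_inter {s t : Set X} (hs : SigmaTwo (AlgGen G) s) (ht : SigmaTwo (AlgGen G) t) :
    SigmaTwo (AlgGen G) (s ∩ t) := by
  obtain ⟨g, hg, rfl⟩ := hs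
  obtain ⟨g', hg', rfl⟩ := ht
  simp only [iUnion_inter, inter_iUnion]
  exact sigma_iUnion fun n => sigma_iUnion fun m => sigma_of (AlgGen.inter (hg _) (hg' _))

/-- Half-line version of `Σ₂`-measurability. -/
lemma meas_of {g : X → ℝ} (h1 : ∀ c : ℝ, SigmaTwo (AlgGen G) {x | c < g x})
    (h2 : ∀ c : ℝ, SigmaTwo (AlgGen G) {x | g x < c}) : SigmaTwoMeasurable (AlgGen G) g := by
  intro U hU
  have : g ⁻¹' U = ⋃ p : {p : ℚ × ℚ // Ioo (p.1 : ℝ) p.2 ⊆ U},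
      ({x | (p.1.1 : ℝ) < g x} ∩ {x | g x < (p.1.2 : ℝ)}) := by
    ext x
    simp only [mem_preimage, mem_iUnion, mem_inter_iff, mem_ofPred_eq]
    constructor
    · intro hx
      obtain ⟨a, b, hab, hs⟩ := mem_nhds_iff_exists_Ioo_subset.1 (hU.mem_nhds hx)
      obtain ⟨p, hp1, hp2⟩ := exists_rat_btwn hab.1
      obtain ⟨q, hq1, hq2⟩ := exists_rat_btwn hab.2
      exact ⟨⟨(p, q), fun y hy => hs ⟨hp1.trans hy.1, hy.2.trans hq2⟩⟩, hp2, hq1⟩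
    · rintro ⟨⟨p, hp⟩, h⟩
      exact hp h
  rw [this]
  exact sigma_iUnion fun p => sigma_inter (h1 _) (h2 _)

lemma meas_gt {g : X → ℝ} (h : SigmaTwoMeasurable (AlgGen G) g) (c : ℝ) :
    SigmaTwo (AlgGen G) {x | c < g x} := h (Ioi c) isOpen_Ioi

lemma meas_lt {g : X → ℝ} (h : SigmaTwoMeasurable (AlgGen G) g) (c : ℝ) :
    SigmaTwo (AlgGen G) {x | g x < c} := h (Iio c) isOpen_Iio

lemma meas_comp {g : X → ℝ} (h : SigmaTwoMeasurable (AlgGen G) g) {φ : ℝ → ℝ}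
    (hφ : Continuous φ) : SigmaTwoMeasurable (AlgGen G) (fun x => φ (g x)) :=
  fun U hU => h (φ ⁻¹' U) (hU.preimage hφ)

lemma sigma_add {f g : X → ℝ} (hf : ∀ c : ℝ, SigmaTwo (AlgGen G) {x | c < f x})
    (hg : ∀ c : ℝ, SigmaTwo (AlgGen G) {x | c < g x}) (c : ℝ) :
    SigmaTwo (AlgGen G) {x | c < f x + g x} := by
  have : {x | c < f x + g x} = ⋃ q : ℚ, ({x | (q : ℝ) < f x} ∩ {x | c - q < g x}) := by
    ext x
    simp only [mem_iUnion, mem_inter_iff, mem_ofPred_eq]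
    constructor
    · intro h
      obtain ⟨q, hq1, hq2⟩ := exists_rat_btwn (show c - g x < f x by linarith)
      exact ⟨q, hq2, by linarith⟩
    · rintro ⟨q, h1, h2⟩
      linarith
  rw [this]
  exact sigma_iUnion fun q => sigma_inter (hf _) (hg _)

lemma meas_neg {g : X → ℝ} (h : SigmaTwoMeasurable (AlgGen G) g) :
    SigmaTwoMeasurable (AlgGen G) (fun x => - g x) := meas_comp h continuous_neg

lemma meas_add {f g : X → ℝ} (hf : SigmaTwoMeasurable (AlgGen G) f)
    (hg : SigmaTwoMeasurable (AlgGen G) g) :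
    SigmaTwoMeasurable (AlgGen G) (fun x => f x + g x) := by
  refine meas_of (sigma_add (meas_gt hf) (meas_gt hg)) fun c => ?_
  convert sigma_add (meas_gt (meas_neg hf)) (meas_gt (meas_neg hg)) (-c) using 3
  constructor <;> intro h <;> linarith

lemma meas_const (c : ℝ) : SigmaTwoMeasurable (AlgGen G) (fun _ : X => c) := by
  intro U hU
  by_cases h : c ∈ U
  · convert sigma_of (AlgGen.compl _ (AlgGen.empty (G := G)))
    simp [h]
  · convert sigma_of (AlgGen.empty (G := G))
    simp [h]

lemma meas_sum {ι : Type*} (t : Finset ι) {f : ι → X → ℝ}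
    (hf : ∀ i, SigmaTwoMeasurable (AlgGen G) (f i)) :
    SigmaTwoMeasurable (AlgGen G) (fun x => ∑ i ∈ t, f i x) := by
  classical
  induction t using Finset.induction_on with
  | empty => simpa using meas_const 0
  | insert a s ha ih =>
    simp only [Finset.sum_insert ha]
    exact meas_add (hf a) ih

end alg

section res
variable {X : Type*} [TopologicalSpace X]

lemma Resolvable.compl {A : Set X} (h : Resolvable A) : Resolvable Aᶜ := by
  intro B hB
  obtain ⟨U, hU, hn, h | h⟩ := h B hB
  · exact ⟨U, hU, hn, Or.inr (by rw [← disjoint_iff_inter_eq_empty]; exact disjoint_compl_right_iff_subset.2 h)⟩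
  · exact ⟨U, hU, hn, Or.inl (by rw [← disjoint_iff_inter_eq_empty] at h; exact subset_compl_iff_disjoint_right.2 h)⟩

lemma Resolvable.union {A A' : Set X} (h : Resolvable A) (h' : Resolvable A') :
    Resolvable (A ∪ A') := by
  intro B hB
  obtain ⟨U, hU, hn, h⟩ := h B hB
  obtain ⟨V, hV, hn', h'⟩ := h' (B ∩ U) hn
  rw [inter_assoc] at hn' h'
  refine ⟨U ∩ V, hU.inter hV, hn', ?_⟩
  have hs : B ∩ (U ∩ V) ⊆ B ∩ U := fun x hx => ⟨hx.1, hx.2.1⟩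
  rcases h with h | h
  · exact Or.inl (hs.trans (h.trans subset_union_left))
  · rcases h' with h' | h'
    · exact Or.inl (h'.trans subset_union_right)
    · right
      rw [inter_union_distrib_left, h', union_empty]
      exact subset_empty_iff.1 ((inter_subset_inter_left _ hs).trans h.subset)

lemma hs_resolvable {A : Set X} (h : Hs X A) : Resolvable A := by
  induction h with
  | basic s h => exact h
  | empty => exact fun B hB => ⟨univ, isOpen_univ, by simpa using hB, Or.inr (by simp)⟩
  | compl s _ h => exact h.compl
  | union s t _ _ h h' => exact h.union h'

end res

universe u

/-- A resolvable set is a union of fibres of an ordinal-valued rank with open initial segments. -/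
lemma exists_rank {X : Type u} [TopologicalSpace X] {A : Set X} (h : Resolvable A) :
    ∃ (r : X → Ordinal.{u}) (S : Set Ordinal.{u}), (∀ α, IsOpen {x | r x < α}) ∧ A = r ⁻¹' S := by
  classical
  have h0 : ∀ W : Set X, ∃ U : Set X, IsOpen U ∧ (W ≠ univ → (Wᶜ ∩ U).Nonempty) ∧
      (Wᶜ ∩ U ⊆ A ∨ Wᶜ ∩ U ∩ A = ∅) := by
    intro W
    by_cases hW : W = univ
    · exact ⟨∅, isOpen_empty, fun h => absurd hW h, by simp⟩
    · obtain ⟨U, h1, h2, h3⟩ := h Wᶜ (nonempty_compl.2 hW)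
      exact ⟨U, h1, fun _ => h2, h3⟩
  choose N hNo hNn hNh using h0
  let O : Ordinal.{u} → Set X := WellFounded.fix (C := fun _ => Set X) (r := (· < ·)) Ordinal.lt_wf
    (fun α f => ⋃ (β : Ordinal.{u}) (h : β < α), (f β h ∪ N (f β h)))
  have hO : ∀ α, O α = ⋃ (β : Ordinal.{u}) (_ : β < α), (O β ∪ N (O β)) := by
    intro α
    exact WellFounded.fix_eq _ _ _
  have hOo : ∀ α, IsOpen (O α) := by
    intro α
    induction α using WellFoundedLT.induction with
    | ind α ih =>
      rw [hO]
      exact isOpen_iUnion fun β => isOpen_iUnion fun hβ => (ih β hβ).union (hNo _)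
  have hsub : ∀ {α β}, β < α → O β ∪ N (O β) ⊆ O α := by
    intro α β hβ
    rw [hO α]
    exact subset_iUnion₂_of_subset β hβ subset_rfl
  have hex : ∃ α, O α = univ := by
    by_contra! hc
    apply not_injective_of_ordinal O
    have : StrictMono O := by
      intro β α hβ
      refine ⟨subset_union_left.trans (hsub hβ), fun hle => ?_⟩
      obtain ⟨x, hx1, hx2⟩ := hNn (O β) (hc β)
      exact hx1 (hle (hsub hβ (Or.inr hx2)))
    exact this.injective
  have hex' : ∀ x, ∃ β, x ∈ O β ∪ N (O β) := by
    intro x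
    obtain ⟨α, hα⟩ := hex
    exact ⟨α, Or.inl (hα ▸ mem_univ x)⟩
  let r : X → Ordinal.{u} := fun x => sInf {β | x ∈ O β ∪ N (O β)}
  have hr : ∀ x, x ∈ O (r x) ∪ N (O (r x)) := fun x => csInf_mem (hex' x)
  have hr2 : ∀ x β, x ∈ O β ∪ N (O β) → r x ≤ β := fun x β h => csInf_le' h
  have hr3 : ∀ α, {x | r x < α} = O α := by
    intro α
    ext x
    rw [hO α]
    simp only [mem_ofPred_eq, mem_iUnion]
    exact ⟨fun h => ⟨r x, h, hr x⟩, fun ⟨β, hβ, h⟩ => (hr2 x β h).trans_lt hβ⟩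
  have hr4 : ∀ x, x ∈ (O (r x))ᶜ ∩ N (O (r x)) := by
    intro x
    have : x ∉ O (r x) := by rw [← hr3]; simp
    exact ⟨this, (hr x).resolve_left this⟩
  refine ⟨r, r '' A, fun α => by rw [hr3]; exact hOo α, ?_⟩
  refine (subset_preimage_image r A).antisymm ?_
  rintro x ⟨y, hy, hxy⟩
  have hy' := hr4 y
  have hx' := hr4 x
  rw [← hxy] at hx'
  rcases hNh (O (r y)) with h | h
  · exact h hx'
  · exact absurd (h.subset ⟨hy', hy⟩) (notMem_empty _)

section radon
variable {K : Type u} [TopologicalSpace K] [CompactSpace K] [T2Space K]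
    [MeasurableSpace K] [BorelSpace K]

instance radonProb_isProb (μ : RadonProb K) : IsProbabilityMeasure μ.measure :=
  inferInstanceAs (IsProbabilityMeasure μ.1.toMeasure)

instance radonProb_inner (μ : RadonProb K) : μ.measure.InnerRegular := μ.2

lemma continuous_radon (g : C(K, ℝ)) :
    Continuous (fun μ : RadonProb K => ∫ x, g x ∂μ.measure) := by
  have := ProbabilityMeasure.continuous_integral_boundedContinuousFunction
    (BoundedContinuousFunction.mkOfCompact g)
  exact this.comp continuous_subtype_val

lemma isOpen_radon {U : Set K} (hU : IsOpen U) (t : ℝ) :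
    IsOpen {μ : RadonProb K | t < μ.measure.real U} := by
  rw [isOpen_iff_mem_nhds]
  intro μ hμ
  rcases lt_or_ge t 0 with ht | ht
  · convert univ_mem
    ext ν
    simpa using ht.trans_le measureReal_nonneg
  have h1 : ENNReal.ofReal t < μ.measure U := by
    rw [← ofReal_measureReal]
    exact (ENNReal.ofReal_lt_ofReal_iff_of_nonneg ht).2 hμ
  obtain ⟨C, hCU, hC, hlt⟩ := hU.measurableSet.exists_lt_isCompact h1
  have hlt' : t < μ.measure.real C := by
    rw [measureReal_def]
    exact (ENNReal.ofReal_lt_iff_lt_toReal ht (measure_ne_top _ _)).1 hlt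
  obtain ⟨g, hg0, hg1, hg⟩ := exists_continuous_zero_one_of_isClosed hU.isClosed_compl hC.isClosed
    (disjoint_compl_left_iff_subset.2 hCU)
  have hint : ∀ ν : RadonProb K, Integrable g ν.measure := fun ν =>
    g.continuous.integrable_of_hasCompactSupport (HasCompactSupport.of_compactSpace _)
  have hop := isOpen_lt continuous_const (continuous_radon g) (f := fun _ => t)
  refine mem_of_superset (hop.mem_nhds ?_) ?_
  · show t < ∫ x, g x ∂μ.measure
    refine hlt'.trans_le ?_
    rw [← integral_indicator_one hC.measurableSet]
    refine integral_mono ((integrable_const 1).indicator hC.measurableSet) (hint _) fun x => ?_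
    by_cases hx : x ∈ C
    · simp [hx, hg1 hx]
    · simpa [hx] using (hg x).1
  · intro ν hν
    show t < ν.measure.real U
    refine (show t < ∫ x, g x ∂ν.measure from hν).trans_le ?_
    rw [← integral_indicator_one hU.measurableSet]
    refine integral_mono (hint _) ((integrable_const 1).indicator hU.measurableSet) fun x => ?_
    by_cases hx : x ∈ U
    · simpa [hx] using (hg x).2
    · simp [hx, hg0 hx]

variable {r : K → Ordinal.{u}} (hr : ∀ α, IsOpen {x | r x < α})

include hr in
lemma meas_fib (β : Ordinal.{u}) : MeasurableSet (r ⁻¹' {β}) := by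
  have : r ⁻¹' {β} = {x | r x < Order.succ β} \ {x | r x < β} := by
    ext x
    simp [le_antisymm_iff]
  rw [this]
  exact (hr _).measurableSet.diff (hr _).measurableSet

include hr in
lemma fib_real (μ : RadonProb K) (β : Ordinal.{u}) : μ.measure.real (r ⁻¹' {β}) =
    μ.measure.real {x | r x < Order.succ β} - μ.measure.real {x | r x < β} := by
  have : r ⁻¹' {β} = {x | r x < Order.succ β} \ {x | r x < β} := by
    ext x
    simp [le_antisymm_iff]
  rw [this, measureReal_sdiff _ (hr _).measurableSet]
  intro x hx
  exact (show r x < β from hx).trans (Order.lt_succ β)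

include hr in
lemma compact_bdd {L : Set K} (hL : IsCompact L) (hne : L.Nonempty) {α : Ordinal.{u}}
    (h : ∀ x ∈ L, r x < α) : ∃ β < α, ∀ x ∈ L, r x ≤ β := by
  obtain ⟨t, ht, hcov⟩ := hL.elim_nhds_subcover (fun x => {y | r y < Order.succ (r x)})
    (fun x _ => (hr _).mem_nhds (show r x < Order.succ (r x) from Order.lt_succ _))
  have htne : t.Nonempty := by
    obtain ⟨x, hx⟩ := hne
    obtain ⟨y, hy, _⟩ := mem_iUnion₂.1 (hcov hx)
    exact ⟨y, hy⟩
  obtain ⟨z, hz, hzmax⟩ := t.exists_max_image r htne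
  refine ⟨r z, h z (ht z hz), fun x hx => ?_⟩
  obtain ⟨y, hy, hxy⟩ := mem_iUnion₂.1 (hcov hx)
  exact (Order.lt_succ_iff.1 hxy).trans (hzmax y hy)

/-- The ordinals carrying positive mass. -/
def posSet (r : K → Ordinal.{u}) (μ : RadonProb K) : Set Ordinal.{u} :=
  {β | 0 < μ.measure (r ⁻¹' {β})}

include hr in
lemma posSet_countable (μ : RadonProb K) : (posSet r μ).Countable :=
  Measure.countable_meas_pos_of_disjoint_iUnion (meas_fib hr) fun i j hij => by
    refine disjoint_left.2 fun x hx hx' => hij ?_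
    simp only [mem_preimage, mem_singleton_iff] at hx hx'
    rw [← hx, ← hx']

include hr in
lemma meas_pre (μ : RadonProb K) {S : Set Ordinal.{u}} (hS : S.Countable) :
    MeasurableSet (r ⁻¹' S) := by
  rw [← biUnion_preimage_singleton]
  exact MeasurableSet.biUnion hS fun β _ => meas_fib hr β

include hr in
lemma posSet_full (μ : RadonProb K) : μ.measure (r ⁻¹' (posSet r μ))ᶜ = 0 := by
  by_contra hne
  obtain ⟨L, hLs, hL, hpos⟩ := (meas_pre hr μ (posSet_countable hr μ)).compl.exists_lt_isCompact
    (pos_iff_ne_zero.2 hne)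
  have hfib : ∀ β, μ.measure (L ∩ r ⁻¹' {β}) = 0 := by
    intro β
    by_cases hβ : β ∈ posSet r μ
    · have : L ∩ r ⁻¹' {β} = ∅ := by
        ext x
        simp only [mem_inter_iff, mem_preimage, mem_singleton_iff, mem_empty_iff_false, iff_false]
        rintro ⟨hx, rfl⟩
        exact hLs hx hβ
      simp [this]
    · have : μ.measure (r ⁻¹' {β}) = 0 := by simpa [posSet] using hβ
      exact measure_mono_null inter_subset_right this
  have key : ∀ α, μ.measure (L ∩ {x | r x < α}) = 0 := by
    intro α
    induction α using WellFoundedLT.induction with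
    | ind α ih =>
      by_contra hc
      obtain ⟨L', hs, hL', hpos'⟩ := (hL.measurableSet.inter
        (hr α).measurableSet).exists_lt_isCompact (pos_iff_ne_zero.2 hc)
      have hne' : L'.Nonempty := nonempty_of_measure_ne_zero hpos'.ne'
      obtain ⟨β, hβ, hb⟩ := compact_bdd hr hL' hne' (fun x hx => (hs hx).2)
      refine hpos'.ne' (measure_mono_null (t := (L ∩ {x | r x < β}) ∪ (L ∩ r ⁻¹' {β})) ?_
        (measure_union_null (ih β hβ) (hfib β)))
      intro x hx
      rcases (hb x hx).lt_or_eq with h | h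
      · exact Or.inl ⟨(hs hx).1, h⟩
      · exact Or.inr ⟨(hs hx).1, h⟩
  obtain ⟨Λ, hΛ⟩ : ∃ Λ, ∀ x, r x < Λ := by
    refine ⟨Order.succ (⨆ x, r x), fun x => Order.lt_succ_iff.2 (Ordinal.le_iSup r x)⟩
  have := key Λ
  rw [show L ∩ {x | r x < Λ} = L from inter_eq_left.2 fun x _ => hΛ x] at this
  exact hpos.ne' this

include hr in
lemma pre_ae (μ : RadonProb K) (S : Set Ordinal.{u}) :
    (r ⁻¹' S : Set K) =ᵐ[μ.measure] (r ⁻¹' (S ∩ posSet r μ) : Set K) := by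
  have h : ∀ᵐ x ∂μ.measure, r x ∈ posSet r μ := by
    rw [ae_iff]
    exact posSet_full hr μ
  filter_upwards [h] with x hx
  exact propext ⟨fun h => ⟨h, hx⟩, fun h => h.1⟩

include hr in
lemma pre_null (μ : RadonProb K) (S : Set Ordinal.{u}) :
    NullMeasurableSet (r ⁻¹' S) μ.measure :=
  ⟨_, meas_pre hr μ ((posSet_countable hr μ).mono inter_subset_right), pre_ae hr μ S⟩

include hr in
lemma exists_finset (μ : RadonProb K) (S : Set Ordinal.{u}) {c : ℝ} 
    (h : c < μ.measure.real (r ⁻¹' S)) :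
    ∃ t : Finset Ordinal.{u}, (∀ β ∈ t, β ∈ S ∧ 0 < μ.measure.real (r ⁻¹' {β})) ∧
      c < ∑ β ∈ t, μ.measure.real (r ⁻¹' {β}) := by
  classical
  rcases lt_or_ge c 0 with hc | hc
  · exact ⟨∅, by simp, by simpa using hc⟩
  have h1 : ENNReal.ofReal c < μ.measure (r ⁻¹' (S ∩ posSet r μ)) := by
    rw [← measure_congr (pre_ae hr μ S), ← ofReal_measureReal]
    exact (ENNReal.ofReal_lt_ofReal_iff_of_nonneg hc).2 h
  have hcount := (posSet_countable hr μ).mono (inter_subset_right (s := S))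
  rw [← biUnion_preimage_singleton, measure_biUnion hcount _ (fun β _ => meas_fib hr β),
    ENNReal.tsum_eq_iSup_sum, lt_iSup_iff] at h1
  · obtain ⟨t, ht⟩ := h1
    refine ⟨t.map (Function.Embedding.subtype _), ?_, ?_⟩
    · intro β hβ
      simp only [Finset.mem_map, Function.Embedding.subtype_apply] at hβ
      obtain ⟨b, _, rfl⟩ := hβ
      exact ⟨b.2.1, ENNReal.toReal_pos b.2.2.ne' (measure_ne_top _ _)⟩
    · rw [Finset.sum_map]
      simp only [Function.Embedding.subtype_apply, measureReal_def]
      rw [← ENNReal.toReal_sum (fun _ _ => measure_ne_top _ _)]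
      refine (ENNReal.ofReal_lt_iff_lt_toReal hc ?_).1 ht
      exact ENNReal.sum_ne_top.2 fun _ _ => measure_ne_top _ _
  · intro i _ j _ hij
    refine disjoint_left.2 fun x hx hx' => hij ?_
    simp only [mem_preimage, mem_singleton_iff] at hx hx'
    rw [← hx, ← hx']

/-- First ordinal at which the mass of the initial segment exceeds `q`. -/
def lev (r : K → Ordinal.{u}) (q : ℝ) (μ : RadonProb K) : Ordinal.{u} :=
  sInf {α | q < μ.measure.real {x | r x < α}}

lemma lev_le {q : ℝ} (hq : q < 1) (μ : RadonProb K) (α : Ordinal.{u}) :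
    lev r q μ ≤ α ↔ q < μ.measure.real {x | r x < α} := by
  have hne : {α | q < μ.measure.real {x | r x < α}}.Nonempty := by
    refine ⟨Order.succ (⨆ x, r x), ?_⟩
    have : {x | r x < Order.succ (⨆ x, r x)} = univ :=
      eq_univ_of_forall fun x => Order.lt_succ_iff.2 (Ordinal.le_iSup r x)
    show q < μ.measure.real _
    rw [this]
    simpa using hq
  constructor
  · intro h
    have h1 : q < μ.measure.real {x | r x < lev r q μ} := csInf_mem hne
    exact h1.trans_le (measureReal_mono fun x hx => lt_of_lt_of_le hx h)
  · intro h
    exact csInf_le' h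

include hr in
lemma resolvable_fib (Q : Finset {q : ℚ // q < 1}) (P : RadonProb K → Prop) :
    Resolvable {μ : RadonProb K | ∀ ν : RadonProb K,
      (∀ q ∈ Q, lev r (q.1 : ℝ) ν = lev r (q.1 : ℝ) μ) → P ν} := by
  intro B hB
  let a : RadonProb K → (Q → Ordinal.{u}) := fun μ q => lev r (q.1.1 : ℝ) μ
  have hq1 : ∀ q : Q, ((q.1.1 : ℚ) : ℝ) < 1 := fun q => by exact_mod_cast q.1.2
  obtain ⟨m, ⟨μ, hμ, rfl⟩, hmin⟩ := WellFounded.has_min (wellFounded_lt (α := Q → Ordinal.{u}))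
    (a '' B) (hB.image a)
  have heq : ∀ ν ∈ B, a ν ≤ a μ → a ν = a μ := fun ν hν hle =>
    by_contra fun hne => hmin (a ν) ⟨ν, hν, rfl⟩ (lt_of_le_of_ne hle hne)
  refine ⟨⋂ q : Q, {ν : RadonProb K | (q.1.1 : ℝ) < ν.measure.real {x | r x < a μ q}},
    isOpen_iInter_of_finite fun q => isOpen_radon (hr _) _, ⟨μ, hμ, ?_⟩, ?_⟩
  · exact mem_iInter.2 fun q => (lev_le (hq1 q) μ _).1 le_rfl
  have hall : ∀ ν ∈ B ∩ ⋂ q : Q, {ν : RadonProb K | (q.1.1 : ℝ) < ν.measure.real {x | r x < a μ q}},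
      ∀ q ∈ Q, lev r (q.1 : ℝ) ν = lev r (q.1 : ℝ) μ := by
    rintro ν ⟨hν, hν2⟩ q hq
    have := heq ν hν fun q => (lev_le (hq1 q) ν _).2 (mem_iInter.1 hν2 q)
    exact congrFun this ⟨q, hq⟩
  by_cases hP : ∀ ν : RadonProb K, (∀ q ∈ Q, lev r (q.1 : ℝ) ν = lev r (q.1 : ℝ) μ) → P ν
  · left
    intro ν hν ρ hρ
    exact hP ρ fun q hq => (hρ q hq).trans (hall ν hν q hq)
  · right
    refine subset_empty_iff.1 ?_
    rintro ν ⟨hν, hν2⟩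
    exact hP fun ρ hρ => hν2 ρ fun q hq => (hρ q hq).trans (hall ν hν q hq).symm

lemma pick {a b η : ℝ} (hab : a < b) (hη : 0 < η) :
    ∃ p q : ℚ, a ≤ p ∧ (q : ℝ) < b ∧ b - a - η < q - p := by
  obtain ⟨p, hp1, hp2⟩ := exists_rat_btwn (show a < a + η / 2 by linarith)
  obtain ⟨q, hq1, hq2⟩ := exists_rat_btwn (show b - η / 2 < b by linarith)
  exact ⟨p, q, hp1.le, hq2, by linarith⟩

include hr in
lemma resolvable_gt (S : Set Ordinal.{u}) (c : ℝ) :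
    SigmaTwo (Hs (RadonProb K)) {μ : RadonProb K | c < μ.measure.real (r ⁻¹' S)} := by
  classical
  have : {μ : RadonProb K | c < μ.measure.real (r ⁻¹' S)} =
      ⋃ Q : Finset {q : ℚ // q < 1}, {μ : RadonProb K | ∀ ν : RadonProb K,
      (∀ q ∈ Q, lev r (q.1 : ℝ) ν = lev r (q.1 : ℝ) μ) → c < ν.measure.real (r ⁻¹' S)} := by
    ext μ
    simp only [mem_iUnion]
    constructor
    swap
    · rintro ⟨Q, h⟩
      exact h μ fun _ _ => rfl
    intro hμ
    obtain ⟨t, ht, hsum⟩ := exists_finset hr μ S hμ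
    set w := ∑ β ∈ t, μ.measure.real (r ⁻¹' {β})
    obtain ⟨η, hη, hη2⟩ : ∃ η : ℝ, 0 < η ∧ c < w - t.card * η := by
      refine ⟨(w - c) / (t.card + 1), by have : 0 < w - c := by linarith
                                         positivity, ?_⟩
      have h1 : (t.card : ℝ) * ((w - c) / (t.card + 1)) < w - c := by
        rw [← mul_div_assoc, div_lt_iff₀ (by positivity)]
        nlinarith
      linarith
    have hch : ∀ β : Ordinal.{u}, ∃ p q : ℚ, p < 1 ∧ q < 1 ∧ (β ∈ t → 
        (μ.measure.real {x | r x < β} ≤ p ∧ (q : ℝ) < μ.measure.real {x | r x < Order.succ β} ∧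
        μ.measure.real (r ⁻¹' {β}) - η < q - p)) := by
      intro β
      by_cases hβ : β ∈ t
      · have hp := (ht β hβ).2
        have hf := fib_real hr μ β
        obtain ⟨p, q, h1, h2, h3⟩ := pick (show μ.measure.real {x | r x < β} <
          μ.measure.real {x | r x < Order.succ β} by linarith)
          (lt_min hη hp)
        have hm1 := min_le_left η (μ.measure.real (r ⁻¹' {β}))
        have hm2 := min_le_right η (μ.measure.real (r ⁻¹' {β}))
        have hq1 : (q : ℝ) < 1 := h2.trans_le measureReal_le_one
        have hpq : (p : ℝ) < q := by linarith
        exact ⟨p, q, by exact_mod_cast hpq.trans hq1, by exact_mod_cast hq1,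
          fun _ => ⟨h1, h2, by linarith⟩⟩
      · exact ⟨0, 0, by simp, by simp, fun h => absurd h hβ⟩
    choose p q hp hq hpq using hch
    refine ⟨t.image (fun β => ⟨p β, hp β⟩) ∪ t.image (fun β => ⟨q β, hq β⟩), fun ν hν => ?_⟩
    have hlow : ∀ β ∈ t, μ.measure.real (r ⁻¹' {β}) - η ≤ ν.measure.real (r ⁻¹' {β}) := by
      intro β hβ
      obtain ⟨h1, h2, h3⟩ := hpq β hβ
      have e1 := hν ⟨p β, hp β⟩ (Finset.mem_union_left _ (Finset.mem_image_of_mem _ hβ))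
      have e2 := hν ⟨q β, hq β⟩ (Finset.mem_union_right _ (Finset.mem_image_of_mem _ hβ))
      simp only at e1 e2
      have hp' : ((p β : ℚ) : ℝ) < 1 := by exact_mod_cast hp β
      have hq' : ((q β : ℚ) : ℝ) < 1 := by exact_mod_cast hq β
      rw [← not_lt, ← lev_le hp', ← e1, lev_le hp', not_lt] at h1
      rw [← lev_le hq', ← e2, lev_le hq'] at h2
      rw [fib_real hr ν]
      linarith
    have hle : ∑ β ∈ t, ν.measure.real (r ⁻¹' {β}) ≤ ν.measure.real (r ⁻¹' S) := by
      rw [← measureReal_biUnion_finset _ (fun β _ => meas_fib hr β)]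
      · refine measureReal_mono (iUnion₂_subset fun β hβ => ?_)
        rintro x hx
        have : r x = β := hx
        exact show r x ∈ S from this ▸ (ht β hβ).1
      · intro i _ j _ hij
        refine disjoint_left.2 fun x hx hx' => hij ?_
        simp only [mem_preimage, mem_singleton_iff] at hx hx'
        rw [← hx, ← hx']
    have hs := Finset.sum_le_sum hlow
    rw [Finset.sum_sub_distrib, Finset.sum_const, nsmul_eq_mul] at hs
    show c < _
    linarith
  rw [this]
  exact sigma_iUnion fun Q => sigma_of (AlgGen.basic _ (resolvable_fib hr Q _))

/-- A set is good if it is universally measurable and its evaluation is `Σ₂`-measurable. -/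
def Good (G : Set (RadonProb K) → Prop) (A : Set K) : Prop :=
  (∀ μ : RadonProb K, NullMeasurableSet A μ.measure) ∧
    SigmaTwoMeasurable (AlgGen G) (fun μ : RadonProb K => μ.measure.real A)

lemma good_hs {A : Set K} (hA : Hs K A) : Good (K := K) (fun s => Resolvable s) A := by
  obtain ⟨r, S, hr, rfl⟩ := exists_rank (hs_resolvable hA)
  refine ⟨fun μ => pre_null hr μ S, meas_of (resolvable_gt hr S) fun c => ?_⟩
  have h := resolvable_gt hr Sᶜ (1 - c)
  have he : {μ : RadonProb K | μ.measure.real (r ⁻¹' S) < c} =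
      {μ : RadonProb K | 1 - c < μ.measure.real (r ⁻¹' Sᶜ)} := by
    ext μ
    simp only [mem_ofPred_eq]
    rw [preimage_compl, probReal_compl_eq_one_sub₀ (pre_null hr μ S)]
    constructor <;> intro h <;> linarith
  rw [he]
  exact h

lemma good_open {U : Set K} (hU : IsOpen U) : Good (K := K) (fun s => IsOpen s) U := by
  refine ⟨fun μ => hU.measurableSet.nullMeasurableSet, meas_of
    (fun c => sigma_of (AlgGen.basic _ (isOpen_radon hU c))) fun c => ?_⟩
  have : {μ : RadonProb K | μ.measure.real U < c} =
      ⋃ q : {q : ℚ // (q : ℝ) < c}, {μ : RadonProb K | (q.1 : ℝ) < μ.measure.real U}ᶜ := by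
    ext μ
    simp only [mem_iUnion, mem_compl_iff, mem_ofPred_eq, not_lt]
    constructor
    · intro h
      obtain ⟨q, h1, h2⟩ := exists_rat_btwn h
      exact ⟨⟨q, h2⟩, h1.le⟩
    · rintro ⟨q, h⟩
      exact h.trans_lt q.2
  rw [this]
  exact sigma_iUnion fun q => sigma_of (AlgGen.compl _ (AlgGen.basic _ (isOpen_radon hU _)))

lemma bos_span {A : Set K} (hA : Bos K A) :
    (A.indicator 1 : K → ℝ) ∈ Submodule.span ℝ {g : K → ℝ | ∃ U, IsOpen U ∧ g = U.indicator 1} := by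
  let M : Submonoid (K → ℝ) :=
    { carrier := {g : K → ℝ | ∃ U, IsOpen U ∧ g = U.indicator 1}
      one_mem' := ⟨univ, isOpen_univ, by simp⟩
      mul_mem' := by
        rintro _ _ ⟨U, hU, rfl⟩ ⟨V, hV, rfl⟩
        exact ⟨U ∩ V, hU.inter hV, by rw [inter_indicator_one]⟩ }
  have hM : Subalgebra.toSubmodule (Algebra.adjoin ℝ (M : Set (K → ℝ))) =
      Submodule.span ℝ (M : Set (K → ℝ)) := by
    rw [Algebra.adjoin_eq_span, Submonoid.closure_eq]
  change _ ∈ Submodule.span ℝ (M : Set (K → ℝ))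
  rw [← hM, Subalgebra.mem_toSubmodule]
  induction hA with
  | basic s h => exact Algebra.subset_adjoin ⟨s, h, rfl⟩
  | empty =>
    rw [indicator_empty']
    exact zero_mem _
  | compl s _ h =>
    rw [indicator_compl]
    exact sub_mem (one_mem _) h
  | union s t _ _ h h' =>
    have : ((s ∪ t).indicator 1 : K → ℝ) = s.indicator 1 + t.indicator 1
        - s.indicator 1 * t.indicator 1 := by
      rw [← inter_indicator_one, ← indicator_union_add_inter, add_sub_cancel_right]
    rw [this]
    exact sub_mem (add_mem h h') (mul_mem h h')

lemma good_bos {A : Set K} (hA : Bos K A) : Good (K := K) (fun s => IsOpen s) A := by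
  have hm : MeasurableSet A := by
    induction hA with
    | basic s h => exact h.measurableSet
    | empty => exact MeasurableSet.empty
    | compl s _ h => exact h.compl
    | union s t _ _ h h' => exact h.union h'
  refine ⟨fun μ => hm.nullMeasurableSet, ?_⟩
  have key : ∀ g ∈ Submodule.span ℝ {g : K → ℝ | ∃ U, IsOpen U ∧ g = U.indicator 1},
      (∀ μ : RadonProb K, Integrable g μ.measure) ∧ SigmaTwoMeasurable
        (AlgGen (fun s => IsOpen s)) (fun μ : RadonProb K => ∫ x, g x ∂μ.measure) := by
    intro g hg
    induction hg using Submodule.span_induction with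
    | mem g h =>
      obtain ⟨U, hU, rfl⟩ := h
      refine ⟨fun μ => (integrable_const 1).indicator hU.measurableSet, ?_⟩
      simp only [integral_indicator_one hU.measurableSet]
      exact (good_open hU).2
    | zero => exact ⟨fun μ => integrable_zero _ _ _, by simpa using meas_const 0⟩
    | add f g _ _ hf hg =>
      refine ⟨fun μ => (hf.1 μ).add (hg.1 μ), ?_⟩
      simp only [Pi.add_apply, integral_add (hf.1 _) (hg.1 _)]
      exact meas_add hf.2 hg.2
    | smul a f _ hf =>
      refine ⟨fun μ => (hf.1 μ).smul a, ?_⟩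
      simp only [Pi.smul_apply, smul_eq_mul, integral_const_mul]
      exact meas_comp hf.2 (continuous_const_mul a)
  have := (key _ (bos_span hA)).2
  simpa only [integral_indicator_one hm] using this

lemma count_bound (N : ℕ) (hN : 0 < N) (y : ℝ) (h0 : 0 ≤ y) (h1 : y ≤ 1) :
    (∑ j ∈ Finset.range N, (if ((j + 1 : ℕ) : ℝ) / N < y then (1 : ℝ) else 0)) / N ≤ y ∧
    y - 1 / N ≤ (∑ j ∈ Finset.range N, (if ((j + 1 : ℕ) : ℝ) / N < y then (1 : ℝ) else 0)) / N := by
  have hN' : (0 : ℝ) < N := by exact_mod_cast hN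
  have hS : (∑ j ∈ Finset.range N, (if ((j + 1 : ℕ) : ℝ) / N < y then (1 : ℝ) else 0))
      = ((⌈N * y⌉₊ - 1 : ℕ) : ℝ) := by
    rw [← Finset.sum_filter, Finset.sum_const, nsmul_eq_mul, mul_one]
    congr 1
    rw [← Finset.card_range (⌈N * y⌉₊ - 1)]
    congr 1
    ext j
    simp only [Finset.mem_filter, Finset.mem_range]
    rw [div_lt_iff₀ hN', mul_comm y, ← Nat.lt_ceil]
    have : ⌈N * y⌉₊ ≤ N := Nat.ceil_le.2 (by nlinarith)
    omega
  rw [hS]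
  have hc1 := Nat.ceil_lt_add_one (show 0 ≤ N * y by positivity)
  have hc2 := Nat.le_ceil (N * y)
  have hc3 : ((⌈N * y⌉₊ - 1 : ℕ) : ℝ) ≤ N * y := by
    rcases Nat.eq_zero_or_pos ⌈N * y⌉₊ with h | h
    · rw [h]; simp; positivity
    · rw [Nat.cast_sub h]; push_cast; linarith
  have hc4 : (⌈N * y⌉₊ : ℝ) - 1 ≤ ((⌈N * y⌉₊ - 1 : ℕ) : ℝ) := by
    have : ⌈N * y⌉₊ ≤ (⌈N * y⌉₊ - 1) + 1 := by omega
    have : (⌈N * y⌉₊ : ℝ) ≤ ((⌈N * y⌉₊ - 1 : ℕ) : ℝ) + 1 := by exact_mod_cast this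
    linarith
  constructor
  · rw [div_le_iff₀ hN']; linarith
  · rw [le_div_iff₀ hN', sub_mul, one_div, inv_mul_cancel₀ hN'.ne']; linarith

lemma algGen_partialUnion {X : Type*} {G : Set X → Prop} {g : ℕ → Set X} (h : ∀ n, AlgGen G (g n))
    (n : ℕ) : AlgGen G (⋃ k ∈ Finset.range n, g k) := by
  induction n with
  | zero => simpa using AlgGen.empty
  | succ n ih =>
    rw [Finset.range_add_one, Finset.set_biUnion_insert]
    exact AlgGen.union _ _ (h n) ih

lemma main_gt {G : Set K → Prop} {G' : Set (RadonProb K) → Prop}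
    (hG : ∀ A, AlgGen G A → Good G' A) (f : K → ℝ) (h0 : ∀ x, 0 ≤ f x) (h1 : ∀ x, f x ≤ 1)
    (hint : ∀ μ : RadonProb K, Integrable f μ.measure) (hf : SigmaTwoMeasurable (AlgGen G) f)
    (c : ℝ) : SigmaTwo (AlgGen G') {μ : RadonProb K | c < ∫ x, f x ∂μ.measure} := by
  classical
  choose g hg hgu using fun t : ℝ => meas_gt hf t
  let B : ℝ → ℕ → Set K := fun t n => ⋃ k ∈ Finset.range n, g t k
  have hB : ∀ t n, AlgGen G (B t n) := fun t n => algGen_partialUnion (hg t) n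
  have hBs : ∀ t n x, x ∈ B t n → t < f x := by
    intro t n x hx
    obtain ⟨k, _, hk⟩ := mem_iUnion₂.1 hx
    exact (hgu t).symm.subset (mem_iUnion.2 ⟨k, hk⟩)
  have hBe : ∀ t x, t < f x → ∀ᶠ n in atTop, x ∈ B t n := by
    intro t x hx
    obtain ⟨k, hk⟩ := mem_iUnion.1 ((hgu t).subset hx)
    filter_upwards [eventually_gt_atTop k] with n hn
    exact mem_iUnion₂.2 ⟨k, Finset.mem_range.2 hn, hk⟩
  let s : ℕ → ℕ → K → ℝ := fun N n x =>
    (∑ j ∈ Finset.range N, (B (((j + 1 : ℕ) : ℝ) / N) n).indicator 1 x) / N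
  have hind : ∀ t n (μ : RadonProb K), Integrable ((B t n).indicator (1 : K → ℝ)) μ.measure :=
    fun t n μ => (integrable_const 1).indicator₀ ((hG _ (hB t n)).1 μ)
  have hsint : ∀ N n (μ : RadonProb K), Integrable (s N n) μ.measure := fun N n μ =>
    (integrable_finsetSum _ fun j _ => hind _ n μ).div_const _
  have hsval : ∀ N n (μ : RadonProb K), ∫ x, s N n x ∂μ.measure =
      (∑ j ∈ Finset.range N, μ.measure.real (B (((j + 1 : ℕ) : ℝ) / N) n)) / N := by
    intro N n μ
    rw [integral_div, integral_finsetSum _ fun j _ => hind _ n μ]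
    congr 1
    refine Finset.sum_congr rfl fun j _ => ?_
    rw [integral_indicator₀ ((hG _ (hB _ n)).1 μ)]
    simp
  have hle : ∀ N n x, 0 < N → s N n x ≤ f x := by
    intro N n x hN
    refine le_trans ?_ (count_bound N hN (f x) (h0 x) (h1 x)).1
    simp only [s]
    gcongr with j _
    by_cases hx : x ∈ B (((j + 1 : ℕ) : ℝ) / N) n
    · rw [if_pos (hBs _ _ _ hx), indicator_of_mem hx]; simp
    · simp only [hx, not_false_eq_true, indicator_of_notMem]; split_ifs <;> norm_num
  have h0s : ∀ N n x, 0 ≤ s N n x := fun N n x => by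
    refine div_nonneg (Finset.sum_nonneg fun j _ => indicator_nonneg (fun _ _ => zero_le_one) _)
      (Nat.cast_nonneg _)
  have htend : ∀ N x, Tendsto (fun n => s N n x) atTop (𝓝 ((∑ j ∈ Finset.range N,
      (if ((j + 1 : ℕ) : ℝ) / N < f x then (1 : ℝ) else 0)) / N)) := by
    intro N x
    refine (tendsto_finsetSum _ fun j _ => ?_).div_const _
    split_ifs with h
    · refine tendsto_const_nhds.congr' ?_
      filter_upwards [hBe _ x h] with n hn
      rw [indicator_of_mem hn]; simp
    · refine tendsto_const_nhds.congr fun n => ?_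
      rw [indicator_of_notMem fun hx => h (hBs _ _ _ hx)]
  have : {μ : RadonProb K | c < ∫ x, f x ∂μ.measure} =
      ⋃ N : ℕ, ⋃ n : ℕ, {μ : RadonProb K | c < (∑ j ∈ Finset.range (N + 1),
        μ.measure.real (B (((j + 1 : ℕ) : ℝ) / (N + 1 : ℕ)) n)) / (N + 1 : ℕ)} := by
    ext μ
    simp only [mem_iUnion, mem_ofPred_eq, ← hsval]
    constructor
    swap
    · rintro ⟨N, n, h⟩
      exact h.trans_le (integral_mono (hsint _ _ _) (hint μ) fun x => hle _ _ _ N.succ_pos)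
    intro hμ
    obtain ⟨N, hN⟩ := exists_nat_one_div_lt (sub_pos.2 hμ)
    refine ⟨N, ?_⟩
    have hT := tendsto_integral_of_dominated_convergence (μ := μ.measure) (fun _ => (1 : ℝ))
      (fun n => (hsint (N + 1) n μ).aestronglyMeasurable) (integrable_const 1)
      (fun n => Eventually.of_forall fun x => by
        rw [Real.norm_of_nonneg (h0s _ _ _)]
        exact (hle _ _ _ N.succ_pos).trans (h1 x))
      (Eventually.of_forall fun x => htend (N + 1) x)
    have hlim : c < ∫ x, (∑ j ∈ Finset.range (N + 1),
      (if ((j + 1 : ℕ) : ℝ) / (N + 1 : ℕ) < f x then (1 : ℝ) else 0)) / (N + 1 : ℕ) ∂μ.measure := by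
      have h2 : ∫ x, (f x - 1 / (N + 1 : ℕ)) ∂μ.measure ≤ ∫ x, (∑ j ∈ Finset.range (N + 1),
        (if ((j + 1 : ℕ) : ℝ) / (N + 1 : ℕ) < f x then (1 : ℝ) else 0)) / (N + 1 : ℕ)
          ∂μ.measure := by
        refine integral_mono ((hint μ).sub (integrable_const _)) ?_
          fun x => (count_bound (N + 1) N.succ_pos (f x) (h0 x) (h1 x)).2
        refine Integrable.of_bound (C := 1) (aestronglyMeasurable_of_tendsto_ae atTop
          (fun n => (hsint (N + 1) n μ).aestronglyMeasurable)
          (Eventually.of_forall fun x => htend (N + 1) x)) (Eventually.of_forall fun x => ?_)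
        rw [Real.norm_of_nonneg]
        · exact (count_bound (N + 1) N.succ_pos (f x) (h0 x) (h1 x)).1.trans (h1 x)
        · exact ge_of_tendsto' (htend (N + 1) x) fun n => h0s _ _ _
      rw [integral_sub (hint μ) (integrable_const _)] at h2
      simp only [integral_const, probReal_univ, smul_eq_mul, one_mul] at h2
      push_cast at h2 hN ⊢
      linarith
    exact (hT.eventually (lt_mem_nhds hlim)).exists
  rw [this]
  refine sigma_iUnion fun N => sigma_iUnion fun n => ?_
  refine meas_gt (meas_comp (φ := fun y => y / (N + 1 : ℕ)) ?_ (continuous_id.div_const _)) c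
  exact meas_sum _ fun j => (hG _ (hB _ n)).2

lemma main_meas {G : Set K → Prop} {G' : Set (RadonProb K) → Prop}
    (hG : ∀ A, AlgGen G A → Good G' A) (f : K → ℝ) (hbdd : ∃ C : ℝ, ∀ x, |f x| ≤ C)
    (hum : UnivMeasurableFn f) (hf : SigmaTwoMeasurable (AlgGen G) f) :
    SigmaTwoMeasurable (AlgGen G') (fun μ : RadonProb K => ∫ x, f x ∂μ.measure) := by
  obtain ⟨C, hC⟩ := hbdd
  obtain ⟨D, hD, hCD⟩ : ∃ D : ℝ, 0 < D ∧ ∀ x, |f x| ≤ D :=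
    ⟨max C 1, lt_max_of_lt_right one_pos, fun x => (hC x).trans (le_max_left _ _)⟩
  have hint : ∀ μ : RadonProb K, Integrable f μ.measure := fun μ =>
    Integrable.of_bound (hum μ.1 μ.2).aestronglyMeasurable D (Eventually.of_forall hCD)
  have half : ∀ e : ℝ, (e = 1 ∨ e = -1) → ∀ c : ℝ,
      SigmaTwo (AlgGen G') {μ : RadonProb K | c < e * ∫ x, f x ∂μ.measure} := by
    intro e he c
    have hb : ∀ x, -D ≤ e * f x ∧ e * f x ≤ D := by
      intro x
      have := abs_le.1 (hCD x)
      rcases he with rfl | rfl <;> constructor <;> linarith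
    have := main_gt hG (fun x => (e * f x + D) / (2 * D))
      (fun x => div_nonneg (by linarith [hb x]) (by linarith))
      (fun x => (div_le_one (by linarith)).2 (by linarith [hb x]))
      (fun μ => (((hint μ).const_mul e).add (integrable_const D)).div_const _)
      (meas_comp hf (φ := fun y => (e * y + D) / (2 * D)) (by fun_prop))
      ((c + D) / (2 * D))
    have he : {μ : RadonProb K | c < e * ∫ x, f x ∂μ.measure} =
      {μ : RadonProb K | (c + D) / (2 * D) < ∫ x, (e * f x + D) / (2 * D) ∂μ.measure} := by
      ext μ
      simp only [mem_ofPred_eq]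
      rw [integral_div, integral_add ((hint μ).const_mul e) (integrable_const D),
        integral_const_mul, div_lt_div_iff_of_pos_right (by linarith)]
      simp
    rw [he]
    exact this
  refine meas_of (fun c => by simpa using half 1 (Or.inl rfl) c) fun c => ?_
  have := half (-1) (Or.inr rfl) (-c)
  simpa using this

end radon

/-- Let `K` be compact Hausdorff, `f : K → ℝ` bounded and universally
measurable, and `f̃(μ) = ∫ f dμ` on `M¹(K)`. If `f ∈ Hf₁(K)` then `f̃ ∈ Hf₁(M¹(K))`;
if `f ∈ Bof₁(K)` then `f̃ ∈ Bof₁(M¹(K))`. -/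
theorem statement5 {K : Type*} [TopologicalSpace K] [CompactSpace K] [T2Space K]
    [MeasurableSpace K] [BorelSpace K]
    (f : K → ℝ) (hbdd : ∃ C : ℝ, ∀ x, |f x| ≤ C) (hum : UnivMeasurableFn f) :
    (HfClass K 1 f →
      HfClass (RadonProb K) 1 (fun μ : RadonProb K => ∫ x, f x ∂(RadonProb.measure μ))) ∧
    (BofClass K 1 f →
      BofClass (RadonProb K) 1 (fun μ : RadonProb K => ∫ x, f x ∂(RadonProb.measure μ))) := by
  simp only [HfClass, BofClass, hf_iff]
  exact ⟨fun h => main_meas (fun A hA => good_hs hA) f hbdd hum h,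
    fun h => main_meas (fun A hA => good_bos hA) f hbdd hum h⟩
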